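/- Let τ₁, τ₂, τ₃ be Borel probability measures on ℝ with reciprocal Cauchy transforms F_{τᵢ}(z) = 1/G_{τᵢ}(z), and suppose F_{τ₃}(z) = F_{τ₁}(F_{τ₂}(z)) for all z ∈ ℂ⁺. For i = 1, 2, 3 let x ↦ κⁱ_x be Borel-measurable families of Borel probability measures on ℝ such that ∫_ℝ 1/(z−y) dκⁱ_x(y) = 1/(F_{τᵢ}(z) − x) for all x ∈ ℝ and z ∈ ℂ⁺. Then the kernels compose: for every x ∈ ℝ and every Borel set B ⊆ ℝ, ∫_ℝ κ²_y(B) dκ¹_x(y) = κ³_x(B). -/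

import Mathlib

open MeasureTheory ProbabilityTheory

/-- The Cauchy transform `G_m(z) = ∫ 1/(z - x) dm(x)` of a measure on `ℝ`. -/
noncomputable def cauchyTransform (m : Measure ℝ) (z : ℂ) : ℂ :=
  ∫ x, (z - (x : ℂ))⁻¹ ∂m

open scoped ENNReal NNReal

open Filter Topology BoundedContinuousFunction

lemma integrable_inv_sub_ofReal (μ : Measure ℝ) [IsFiniteMeasure μ] {z : ℂ} (hz : 0 < z.im) :
    Integrable (fun x : ℝ ↦ (z - (x : ℂ))⁻¹) μ := by
  refine Integrable.of_bound (by fun_prop) (z.im)⁻¹ (ae_of_all _ fun x ↦ ?_)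
  rw [norm_inv]
  have h := Complex.abs_im_le_norm (z - (x : ℂ))
  simp only [Complex.sub_im, Complex.ofReal_im, sub_zero] at h
  exact inv_anti₀ hz ((le_abs_self _).trans h)

lemma neg_im_inv_sub_ofReal (z : ℂ) (x : ℝ) :
    -((z - (x : ℂ))⁻¹).im = z.im / ((z.re - x) ^ 2 + z.im ^ 2) := by
  simp [Complex.inv_im, Complex.normSq_apply, sq, neg_div]

lemma integral_im_cauchyTransform (μ : Measure ℝ) [IsFiniteMeasure μ] {z : ℂ} (hz : 0 < z.im) :
    ∫ x : ℝ, z.im / ((z.re - x) ^ 2 + z.im ^ 2) ∂μ = -(cauchyTransform μ z).im := by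
  have h := integral_im (integrable_inv_sub_ofReal μ hz)
  simp only [RCLike.im_to_complex] at h
  rw [cauchyTransform, ← h, ← integral_neg]
  simp_rw [neg_im_inv_sub_ofReal]

lemma integrable_poisson (μ : Measure ℝ) [IsFiniteMeasure μ] {z : ℂ} (hz : 0 < z.im) :
    Integrable (fun x : ℝ ↦ z.im / ((z.re - x) ^ 2 + z.im ^ 2)) μ := by
  have h := (integrable_inv_sub_ofReal μ hz).im.neg
  refine h.congr (ae_of_all _ fun x ↦ ?_)
  simpa using neg_im_inv_sub_ofReal z x

lemma cauchyTransform_im_neg (μ : Measure ℝ) [IsProbabilityMeasure μ] {z : ℂ} (hz : 0 < z.im) :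
    (cauchyTransform μ z).im < 0 := by
  rw [← neg_pos, ← integral_im_cauchyTransform μ hz]
  have hpos : ∀ x : ℝ, 0 < z.im / ((z.re - x) ^ 2 + z.im ^ 2) := fun x ↦ by positivity
  rw [integral_pos_iff_support_of_nonneg (fun x ↦ (hpos x).le) (integrable_poisson μ hz)]
  have : Function.support (fun x : ℝ ↦ z.im / ((z.re - x) ^ 2 + z.im ^ 2)) = Set.univ :=
    Set.eq_univ_of_forall fun x ↦ (hpos x).ne'
  simp [this]

lemma inv_cauchyTransform_im_pos (μ : Measure ℝ) [IsProbabilityMeasure μ] {z : ℂ}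
    (hz : 0 < z.im) : 0 < ((cauchyTransform μ z)⁻¹).im := by
  have h := cauchyTransform_im_neg μ hz
  rw [Complex.inv_im]
  refine div_pos (neg_pos.2 h) (Complex.normSq_pos.2 fun h0 ↦ ?_)
  simp [h0] at h

lemma lintegral_poisson (μ : Measure ℝ) [IsFiniteMeasure μ] (t : ℝ) {ε : ℝ} (hε : 0 < ε) :
    ∫⁻ x, ENNReal.ofReal (ε / ((t - x) ^ 2 + ε ^ 2)) ∂μ =
      ENNReal.ofReal (-(cauchyTransform μ ⟨t, ε⟩).im) := by
  have hz : 0 < (⟨t, ε⟩ : ℂ).im := hε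
  rw [← integral_im_cauchyTransform μ hz, ofReal_integral_eq_lintegral_ofReal
    (integrable_poisson μ hz) (ae_of_all _ fun x ↦ by positivity)]

/-- Rescaling of the Poisson kernel of the half-plane. -/
lemma lintegral_comp_add_mul_inv_one_add_sq {g : ℝ → ℝ≥0∞} (hg : Measurable g) (x : ℝ) {ε : ℝ}
    (hε : 0 < ε) :
    ∫⁻ s, g (x + ε * s) * ENNReal.ofReal ((1 + s ^ 2)⁻¹) =
      ∫⁻ t, g t * ENNReal.ofReal (ε / ((t - x) ^ 2 + ε ^ 2)) := by
  rw [← lintegral_add_left_eq_self (fun t ↦ g t * ENNReal.ofReal (ε / ((t - x) ^ 2 + ε ^ 2))) x]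
  conv_rhs => rw [← Real.smul_map_volume_mul_left hε.ne']
  rw [lintegral_smul_measure, lintegral_map (by fun_prop) (by fun_prop), smul_eq_mul,
    ← lintegral_const_mul _ (by fun_prop)]
  refine lintegral_congr fun s ↦ ?_
  rw [mul_left_comm, ← ENNReal.ofReal_mul (abs_nonneg _), abs_of_pos hε]
  congr 2
  rw [add_sub_cancel_left]
  have : 0 < 1 + s ^ 2 := by positivity
  field_simp
  ring

lemma lintegral_poisson_average {μ : Measure ℝ} [IsFiniteMeasure μ] {g : ℝ → ℝ≥0∞}
    (hg : Measurable g) {ε : ℝ} (hε : 0 < ε) :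
    ∫⁻ x, ∫⁻ s, g (x + ε * s) * ENNReal.ofReal ((1 + s ^ 2)⁻¹) ∂volume ∂μ =
      ∫⁻ t, g t * ENNReal.ofReal (-(cauchyTransform μ ⟨t, ε⟩).im) := by
  simp_rw [lintegral_comp_add_mul_inv_one_add_sq hg _ hε]
  rw [lintegral_lintegral_swap (by fun_prop)]
  refine lintegral_congr fun t ↦ ?_
  rw [lintegral_const_mul _ (by fun_prop), lintegral_poisson μ t hε]

lemma lintegral_inv_one_add_sq :
    ∫⁻ s : ℝ, ENNReal.ofReal ((1 + s ^ 2)⁻¹) = ENNReal.ofReal Real.pi := by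
  rw [← ofReal_integral_eq_lintegral_ofReal integrable_inv_one_add_sq
    (ae_of_all _ fun x ↦ by positivity), integral_univ_inv_one_add_sq]

lemma tendsto_lintegral_poisson_average (μ : Measure ℝ) [IsFiniteMeasure μ] (f : ℝ →ᵇ ℝ≥0)
    {u : ℕ → ℝ} (hu : Tendsto u atTop (𝓝 0)) :
    Tendsto (fun n ↦ ∫⁻ x, ∫⁻ s, (f (x + u n * s) : ℝ≥0∞) *
        ENNReal.ofReal ((1 + s ^ 2)⁻¹) ∂volume ∂μ)
      atTop (𝓝 ((∫⁻ x, f x ∂μ) * ENNReal.ofReal Real.pi)) := by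
  have hf : Continuous f := f.continuous
  have hlim : (∫⁻ x, f x ∂μ) * ENNReal.ofReal Real.pi =
      ∫⁻ p : ℝ × ℝ, (f p.1 : ℝ≥0∞) * ENNReal.ofReal ((1 + p.2 ^ 2)⁻¹) ∂(μ.prod volume) := by
    rw [lintegral_prod_mul (f := fun x ↦ (f x : ℝ≥0∞))
      (g := fun s : ℝ ↦ ENNReal.ofReal ((1 + s ^ 2)⁻¹)) (by fun_prop) (by fun_prop),
      lintegral_inv_one_add_sq]
  have hprod : ∀ n, ∫⁻ x, ∫⁻ s, (f (x + u n * s) : ℝ≥0∞) *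
        ENNReal.ofReal ((1 + s ^ 2)⁻¹) ∂volume ∂μ =
      ∫⁻ p : ℝ × ℝ, (f (p.1 + u n * p.2) : ℝ≥0∞) *
        ENNReal.ofReal ((1 + p.2 ^ 2)⁻¹) ∂(μ.prod volume) := fun n ↦ by
    rw [lintegral_prod _ (by fun_prop)]
  simp_rw [hprod, hlim]
  refine tendsto_lintegral_of_dominated_convergence
    (fun p ↦ (nndist f 0 : ℝ≥0∞) * ENNReal.ofReal ((1 + p.2 ^ 2)⁻¹))
    (fun n ↦ by fun_prop) (fun n ↦ ae_of_all _ fun p ↦ ?_) ?_ (ae_of_all _ fun p ↦ ?_)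
  · exact mul_le_mul_left (ENNReal.coe_le_coe.2 (NNReal.upper_bound f _)) _
  · rw [lintegral_prod_mul (f := fun _ ↦ (nndist f 0 : ℝ≥0∞))
      (g := fun s : ℝ ↦ ENNReal.ofReal ((1 + s ^ 2)⁻¹)) (by fun_prop) (by fun_prop),
      lintegral_inv_one_add_sq, lintegral_const]
    exact ENNReal.mul_ne_top (ENNReal.mul_ne_top ENNReal.coe_ne_top (measure_ne_top _ _))
      ENNReal.ofReal_ne_top
  · refine ENNReal.Tendsto.mul_const (ENNReal.tendsto_coe.2 ?_) (Or.inr ENNReal.ofReal_ne_top)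
    have h : Tendsto (fun n ↦ p.1 + u n * p.2) atTop (𝓝 p.1) := by
      simpa using (hu.mul_const p.2).const_add p.1
    exact (hf.tendsto p.1).comp h

/-- A finite measure on `ℝ` is determined by its Cauchy transform on the upper half-plane. -/
theorem measure_ext_of_cauchyTransform_eq {μ ν : Measure ℝ} [IsFiniteMeasure μ]
    [IsFiniteMeasure ν] (h : ∀ z : ℂ, 0 < z.im → cauchyTransform μ z = cauchyTransform ν z) :
    μ = ν := by
  refine ext_of_forall_lintegral_eq_of_IsFiniteMeasure fun f ↦ ?_
  have hu := tendsto_one_div_add_atTop_nhds_zero_nat (𝕜 := ℝ)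
  have hf : Measurable fun x ↦ (f x : ℝ≥0∞) := by
    have := f.continuous
    fun_prop
  have key := tendsto_lintegral_poisson_average μ f hu
  have hμν : ∀ n : ℕ, ∫⁻ x, ∫⁻ s, (f (x + 1 / ((n : ℝ) + 1) * s) : ℝ≥0∞) *
        ENNReal.ofReal ((1 + s ^ 2)⁻¹) ∂volume ∂μ =
      ∫⁻ x, ∫⁻ s, (f (x + 1 / ((n : ℝ) + 1) * s) : ℝ≥0∞) *
        ENNReal.ofReal ((1 + s ^ 2)⁻¹) ∂volume ∂ν := fun n ↦ by
    have hn : 0 < 1 / ((n : ℝ) + 1) := by positivity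
    rw [lintegral_poisson_average hf hn, lintegral_poisson_average hf hn]
    refine lintegral_congr fun t ↦ ?_
    rw [h _ hn]
  simp_rw [hμν] at key
  have heq := tendsto_nhds_unique key (tendsto_lintegral_poisson_average ν f hu)
  exact (ENNReal.mul_left_inj (by simpa using Real.pi_pos) ENNReal.ofReal_ne_top).1 heq

/-- Chapman–Kolmogorov property of the transition kernels of a monotone convolution
semigroup: if `F_{τ₃} = F_{τ₁} ∘ F_{τ₂}` on `ℂ⁺` and the Markov kernels `κⁱ` satisfy
`∫ 1/(z-y) dκⁱ_x(y) = 1/(F_{τᵢ}(z) - x)`, then `∫ κ²_y(B) dκ¹_x(y) = κ³_x(B)`. -/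
theorem stmt_10 (τ₁ τ₂ τ₃ : Measure ℝ)
    [IsProbabilityMeasure τ₁] [IsProbabilityMeasure τ₂] [IsProbabilityMeasure τ₃]
    (hF : ∀ z : ℂ, 0 < z.im →
      (cauchyTransform τ₃ z)⁻¹ = (cauchyTransform τ₁ ((cauchyTransform τ₂ z)⁻¹))⁻¹)
    (κ₁ κ₂ κ₃ : Kernel ℝ ℝ)
    [IsMarkovKernel κ₁] [IsMarkovKernel κ₂] [IsMarkovKernel κ₃]
    (h₁ : ∀ (x : ℝ) (z : ℂ), 0 < z.im →
      ∫ y, (z - (y : ℂ))⁻¹ ∂(κ₁ x) = ((cauchyTransform τ₁ z)⁻¹ - (x : ℂ))⁻¹)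
    (h₂ : ∀ (x : ℝ) (z : ℂ), 0 < z.im →
      ∫ y, (z - (y : ℂ))⁻¹ ∂(κ₂ x) = ((cauchyTransform τ₂ z)⁻¹ - (x : ℂ))⁻¹)
    (h₃ : ∀ (x : ℝ) (z : ℂ), 0 < z.im →
      ∫ y, (z - (y : ℂ))⁻¹ ∂(κ₃ x) = ((cauchyTransform τ₃ z)⁻¹ - (x : ℂ))⁻¹) :
    ∀ (x : ℝ) (B : Set ℝ), MeasurableSet B →
      ∫⁻ y, κ₂ y B ∂(κ₁ x) = κ₃ x B := by
  intro x B hB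
  rw [← Kernel.comp_apply' κ₂ κ₁ x hB]
  congr 1
  refine measure_ext_of_cauchyTransform_eq fun z hz ↦ ?_
  rw [cauchyTransform, cauchyTransform, h₃ x z hz,
    Kernel.integral_comp (integrable_inv_sub_ofReal _ hz), hF z hz,
    ← h₁ x _ (inv_cauchyTransform_im_pos τ₂ hz)]
  exact integral_congr_ae (ae_of_all _ fun y ↦ h₂ y z hz)
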